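/- Let a, b, c be nonnegative integers with a + c ≥ 1 and a + 2b + 3c ≡ 0 (mod 4), set d = a + b + c − 1, and let Δ ⊂ ℝ^d be a lattice simplex of dimension d such that, for some ordering of its vertices, Λ_Δ equals the cyclic subgroup Λ_1(a,b,c) of (ℝ/ℤ)^{a+b+c} generated by the element whose first a coordinates are 1/4, next b coordinates are 1/2, and last c coordinates are 3/4. Then Vol(Δ) = 4 and δ(Δ,t) = 1 + t^{(a+2b+3c)/4} + t^{(a+c)/2} + t^{(3a+2b+c)/4}. -/

import Mathlib

open Pointwise Polynomial

noncomputable section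

/-- The set of lattice points of `ℝ^d` (points with integer coordinates). -/
def latticePts (d : ℕ) : Set (Fin d → ℝ) := {x | ∀ i, ∃ z : ℤ, x i = (z : ℝ)}

/-- A lattice polytope: the convex hull of finitely many lattice points. -/
def IsLatticePolytope {d : ℕ} (P : Set (Fin d → ℝ)) : Prop :=
  ∃ V : Finset (Fin d → ℝ), (V : Set (Fin d → ℝ)) ⊆ latticePts d ∧
    P = convexHull ℝ (V : Set (Fin d → ℝ))

/-- `|nP ∩ ℤ^d|`. -/
def ehrhartCount {d : ℕ} (P : Set (Fin d → ℝ)) (n : ℕ) : ℕ :=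
  (latticePts d ∩ (n : ℝ) • P).ncard

/-- The Ehrhart series `1 + Σ_{n ≥ 1} |nP ∩ ℤ^d| tⁿ`. -/
def ehrhartSeries {d : ℕ} (P : Set (Fin d → ℝ)) : PowerSeries ℤ :=
  PowerSeries.mk fun n => if n = 0 then 1 else (ehrhartCount P n : ℤ)

/-- `p` is the δ-polynomial of the lattice polytope `P ⊆ ℝ^d` of dimension `d`,
i.e. `(1 - t)^(d+1) (1 + Σ_{n ≥ 1} |nP ∩ ℤ^d| tⁿ) = p`. -/
def HasDeltaPoly {d : ℕ} (P : Set (Fin d → ℝ)) (p : Polynomial ℤ) : Prop :=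
  (1 - PowerSeries.X) ^ (d + 1) * ehrhartSeries P = (p : PowerSeries ℤ)

/-- Unimodular equivalence: an affine map carrying `ℤ^d ∩ aff P` bijectively onto
`ℤ^e ∩ aff Q` and mapping `P` onto `Q`. -/
def UnimodEquiv {d e : ℕ} (P : Set (Fin d → ℝ)) (Q : Set (Fin e → ℝ)) : Prop :=
  ∃ f : (Fin d → ℝ) →ᵃ[ℝ] (Fin e → ℝ),
    Set.BijOn f (latticePts d ∩ (affineSpan ℝ P : Set (Fin d → ℝ)))
      (latticePts e ∩ (affineSpan ℝ Q : Set (Fin e → ℝ))) ∧ f '' P = Q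

/-- The lattice pyramid `Pyr(Q) = conv(Q × {0}, (0,…,0,1)) ⊆ ℝ^{e+1}`. -/
def pyramidOver {e : ℕ} (Q : Set (Fin e → ℝ)) : Set (Fin (e + 1) → ℝ) :=
  convexHull ℝ
    ((fun x : Fin e → ℝ => Fin.snoc x (0 : ℝ)) '' Q ∪ {Fin.snoc (0 : Fin e → ℝ) (1 : ℝ)})

/-- `P` is a lattice pyramid over some (full-dimensional) lattice polytope. -/
def IsLatticePyramid {d : ℕ} (P : Set (Fin d → ℝ)) : Prop :=
  ∃ (e : ℕ) (Q : Set (Fin e → ℝ)), IsLatticePolytope Q ∧ affineSpan ℝ Q = ⊤ ∧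
    UnimodEquiv P (pyramidOver Q)

/-- `P ⊆ ℝ^d` is a simplex (of some dimension). -/
def IsSimplex {d : ℕ} (P : Set (Fin d → ℝ)) : Prop :=
  ∃ (n : ℕ) (v : Fin (n + 1) → Fin d → ℝ), AffineIndependent ℝ v ∧
    P = convexHull ℝ (Set.range v)

/-- A full-dimensional lattice simplex of dimension `d` in `ℝ^d`. -/
def IsLatticeSimplexFD {d : ℕ} (Δ : Set (Fin d → ℝ)) : Prop :=
  ∃ v : Fin (d + 1) → Fin d → ℝ, AffineIndependent ℝ v ∧
    (∀ i, v i ∈ latticePts d) ∧ Δ = convexHull ℝ (Set.range v)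

/-- `ℤ((P,1) ∩ ℤ^{d+1}) = ℤ^{d+1}`: the lattice points of `P`, with last coordinate `1`
appended, generate all of `ℤ^{d+1}` as a group. -/
def SpansLattice {d : ℕ} (P : Set (Fin d → ℝ)) : Prop :=
  AddSubgroup.closure {y : Fin (d + 1) → ℤ |
    y (Fin.last d) = 1 ∧ (fun i : Fin d => (y i.castSucc : ℝ)) ∈ P} = ⊤

/-- The finite abelian group `Λ_Δ ⊆ (ℝ/ℤ)^{d+1}` attached to a lattice simplex with
ordered vertices `v 0, …, v d`, encoded by its canonical representatives in `[0,1)`. -/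
def simplexLambda {d : ℕ} (v : Fin (d + 1) → Fin d → ℝ) : Set (Fin (d + 1) → ℝ) :=
  {c | (∀ i, 0 ≤ c i ∧ c i < 1) ∧
    (∀ j : Fin d, ∃ z : ℤ, (∑ i, c i * v i j) = (z : ℝ)) ∧
    (∃ z : ℤ, (∑ i, c i) = (z : ℝ))}

/-- The standard basis vector `e_j` of `ℝ^d` (0-indexed). -/
def stdE (d : ℕ) (j : Fin d) : Fin d → ℝ := fun i => if i = j then 1 else 0

/-- The cyclic group `Λ₁(a,b,c) = ⟨(1/4,…,1/4, 1/2,…,1/2, 3/4,…,3/4)⟩ ⊆ (ℝ/ℤ)^{a+b+c}`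
(blocks of lengths `a`, `b`, `c`), encoded by representatives in `[0,1)`. -/
def lambdaOne (d a b : ℕ) : Set (Fin (d + 1) → ℝ) :=
  {x | ∃ j : Fin 4, x = fun i : Fin (d + 1) =>
    Int.fract ((j.val : ℝ) *
      (if (i : ℕ) < a then (1 : ℝ) / 4 else if (i : ℕ) < a + b then 1 / 2 else 3 / 4))}


theorem convexHull_range_eq_image_stdSimplex {ι E : Type*} [Fintype ι] [AddCommGroup E]
    [Module ℝ E] (v : ι → E) :
    convexHull ℝ (Set.range v) = Fintype.linearCombination ℝ v '' stdSimplex ℝ ι := by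
  classical
  rw [← convexHull_basis_eq_stdSimplex, LinearMap.image_convexHull, ← Set.range_comp]
  congr 2
  ext i
  simp [Fintype.linearCombination_apply]

theorem mem_smul_convexHull_range_iff {ι E : Type*} [Fintype ι] [Nonempty ι] [AddCommGroup E]
    [Module ℝ E] (v : ι → E) (n : ℕ) (x : E) :
    x ∈ (n : ℝ) • convexHull ℝ (Set.range v) ↔
      ∃ w : ι → ℝ, (∀ i, 0 ≤ w i) ∧ ∑ i, w i = n ∧ ∑ i, w i • v i = x := by
  rw [convexHull_range_eq_image_stdSimplex]
  constructor
  · rintro ⟨_, ⟨w, ⟨h0, h1⟩, rfl⟩, rfl⟩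
    refine ⟨fun i => n * w i, fun i => mul_nonneg n.cast_nonneg (h0 i), ?_, ?_⟩
    · rw [← Finset.mul_sum, h1, mul_one]
    · simp [Fintype.linearCombination_apply, Finset.smul_sum, mul_smul]
  · rintro ⟨w, h0, h1, rfl⟩
    rcases Nat.eq_zero_or_pos n with rfl | hn
    · have hw : ∀ i, w i = 0 := by
        simpa [Finset.sum_eq_zero_iff_of_nonneg fun i _ => h0 i] using h1
      obtain ⟨i⟩ := ‹Nonempty ι›
      classical
      exact ⟨v i, ⟨Pi.single i 1, single_mem_stdSimplex ℝ i, by simp⟩, by simp [hw]⟩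
    · have hn' : (n : ℝ) ≠ 0 := by positivity
      refine ⟨_, ⟨fun i => (n : ℝ)⁻¹ * w i, ⟨fun i => mul_nonneg (by positivity) (h0 i), ?_⟩, rfl⟩,
        ?_⟩
      · rw [← Finset.mul_sum, h1, inv_mul_cancel₀ hn']
      · simp [Fintype.linearCombination_apply, Finset.smul_sum, ← mul_smul, hn']

theorem AffineIndependent.injOn_sum_smul {ι E : Type*} [Fintype ι] [AddCommGroup E]
    [Module ℝ E] {v : ι → E} (hv : AffineIndependent ℝ v) {w w' : ι → ℝ}
    (h1 : ∑ i, w i = ∑ i, w' i) (h2 : ∑ i, w i • v i = ∑ i, w' i • v i) : w = w' := by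
  funext i
  exact sub_eq_zero.1 <| hv.eq_zero_of_sum_eq_zero (s := Finset.univ) (w := w - w')
    (by simp [h1]) (by simp [sub_smul, h2]) i (Finset.mem_univ i)

theorem mem_latticePts_sum_smul_iff {d : ℕ} {ι : Type*} [Fintype ι] {v : ι → Fin d → ℝ}
    (w : ι → ℝ) :
    ∑ i, w i • v i ∈ latticePts d ↔ ∀ j, ∃ z : ℤ, ∑ i, w i * v i j = z := by
  simp [latticePts]

theorem add_mem_latticePts_iff {d : ℕ} {x y : Fin d → ℝ} (hy : y ∈ latticePts d) :
    x + y ∈ latticePts d ↔ x ∈ latticePts d := by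
  refine forall_congr' fun i => ?_
  obtain ⟨z, hz⟩ := hy i
  constructor
  · rintro ⟨t, ht⟩
    exact ⟨t - z, by push_cast; rw [← ht, ← hz]; simp⟩
  · rintro ⟨t, ht⟩
    exact ⟨t + z, by push_cast; rw [← ht, ← hz]; simp⟩

theorem sum_natCast_smul_mem_latticePts {d : ℕ} {ι : Type*} [Fintype ι] {v : ι → Fin d → ℝ}
    (hvl : ∀ i, v i ∈ latticePts d) (m : ι → ℕ) :
    ∑ i, (m i : ℝ) • v i ∈ latticePts d := by
  intro j
  choose z hz using fun i => hvl i j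
  exact ⟨∑ i, m i * z i, by simp [hz]⟩

/-- The Ehrhart counting function of a lattice simplex, in terms of the heights `h k` of the
elements `φ k` of the group attached to it. -/
theorem ehrhartCount_convexHull_range {d : ℕ} {v : Fin (d + 1) → Fin d → ℝ}
    (hv : AffineIndependent ℝ v) (hvl : ∀ i, v i ∈ latticePts d) {κ : Type*} [Fintype κ]
    {φ : κ → Fin (d + 1) → ℝ} (hφ : Function.Injective φ) (hΛ : simplexLambda v = Set.range φ)
    {h : κ → ℕ} (hh : ∀ k, ∑ i, φ k i = h k) (n : ℕ) :
    ehrhartCount (convexHull ℝ (Set.range v)) n =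
      ∑ k, if h k ≤ n then (d + (n - h k)).choose d else 0 := by
  classical
  have hmem : ∀ k, φ k ∈ simplexLambda v := fun k => hΛ ▸ ⟨k, rfl⟩
  let T : Finset (Σ _ : κ, Fin (d + 1) →₀ ℕ) := Finset.univ.sigma fun k =>
    if h k ≤ n then Finset.finsuppAntidiag Finset.univ (n - h k) else ∅
  have hT : ∀ k m, (⟨k, m⟩ : Σ _ : κ, Fin (d + 1) →₀ ℕ) ∈ T ↔ h k + ∑ i, m i = n := by
    intro k m
    simp only [T, Finset.mem_sigma, Finset.mem_univ, true_and]
    split_ifs with hk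
    · exact Iff.trans (b := ∑ i, m i = n - h k) (by simp) (by omega)
    · simp only [Finset.notMem_empty, false_iff]
      omega
  let F : (Σ _ : κ, Fin (d + 1) →₀ ℕ) → Fin d → ℝ := fun p =>
    ∑ i, (φ p.1 i + p.2 i) • v i
  have hsum : ∀ k (m : Fin (d + 1) →₀ ℕ), h k + ∑ i, m i = n → ∑ i, (φ k i + m i) = n := by
    intro k m hkm
    rw [Finset.sum_add_distrib, hh]
    exact_mod_cast hkm
  have hinj : Set.InjOn F T := by
    rintro ⟨k, m⟩ hp ⟨k', m'⟩ hp' heq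
    have hw := hv.injOn_sum_smul ((hsum k m ((hT k m).1 hp)).trans
      (hsum k' m' ((hT k' m').1 hp')).symm) heq
    have hm : ∀ i, φ k i = φ k' i ∧ m i = m' i := by
      intro i
      have h1 : φ k i + m i = φ k' i + m' i := congrFun hw i
      have a1 := (hmem k).1 i
      have a2 := (hmem k').1 i
      have h2 : m i = m' i := by
        have e1 : (m i : ℝ) < m' i + 1 := by linarith
        have e2 : (m' i : ℝ) < m i + 1 := by linarith
        norm_cast at e1 e2
        omega
      rw [h2] at h1
      exact ⟨by linarith, h2⟩
    obtain rfl : k = k' := hφ (funext fun i => (hm i).1)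
    obtain rfl : m = m' := Finsupp.ext fun i => (hm i).2
    rfl
  have himg : latticePts d ∩ (n : ℝ) • convexHull ℝ (Set.range v) = F '' T := by
    ext x
    rw [Set.mem_inter_iff, mem_smul_convexHull_range_iff]
    constructor
    · rintro ⟨hx, w, h0, h1, rfl⟩
      have hw : ∀ i, Int.fract (w i) + (⌊w i⌋₊ : ℝ) = w i := fun i => by
        rw [natCast_floor_eq_intCast_floor (h0 i), Int.fract_add_floor]
      have hf : (fun i => Int.fract (w i)) ∈ simplexLambda v := by
        refine ⟨fun i => ⟨Int.fract_nonneg _, Int.fract_lt_one _⟩, ?_, n - ∑ i, (⌊w i⌋₊ : ℤ), ?_⟩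
        · rw [← mem_latticePts_sum_smul_iff,
            ← add_mem_latticePts_iff (sum_natCast_smul_mem_latticePts hvl fun i => ⌊w i⌋₊),
            ← Finset.sum_add_distrib]
          simpa only [← add_smul, hw] using hx
        · push_cast
          rw [← h1, ← Finset.sum_sub_distrib]
          exact Finset.sum_congr rfl fun i _ => by linarith [hw i]
      rw [hΛ] at hf
      obtain ⟨k, hk⟩ := hf
      have hk' : ∀ i, φ k i = Int.fract (w i) := congrFun hk
      refine ⟨⟨k, Finsupp.equivFunOnFinite.symm fun i => ⌊w i⌋₊⟩, (hT _ _).2 ?_, ?_⟩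
      · have : (h k : ℝ) + ∑ i, (⌊w i⌋₊ : ℝ) = n := by
          simp [← hh, ← h1, ← Finset.sum_add_distrib, hk', hw]
        simpa using mod_cast this
      · simp [F, hk', hw]
    · rintro ⟨⟨k, m⟩, hp, rfl⟩
      refine ⟨?_, fun i => φ k i + m i, fun i => add_nonneg ((hmem k).1 i).1 (Nat.cast_nonneg _),
        hsum k m ((hT k m).1 hp), rfl⟩
      simp only [F, add_smul, Finset.sum_add_distrib]
      rw [add_mem_latticePts_iff (sum_natCast_smul_mem_latticePts hvl m),
        mem_latticePts_sum_smul_iff]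
      exact (hmem k).2.1
  rw [ehrhartCount, himg, hinj.ncard_image, Set.ncard_coe_finset, Finset.card_sigma]
  refine Finset.sum_congr rfl fun k _ => ?_
  split_ifs
  · rw [Finset.card_finsuppAntidiag_nat_eq_choose, Finset.card_univ, Fintype.card_fin,
      Nat.add_right_comm, Nat.add_sub_cancel, Nat.choose_symm_add]
  · rfl

/-- The δ-polynomial of a lattice simplex is the generating function of the heights of the
elements of the group attached to it. -/
theorem hasDeltaPoly_convexHull_range {d : ℕ} {v : Fin (d + 1) → Fin d → ℝ}
    (hv : AffineIndependent ℝ v) (hvl : ∀ i, v i ∈ latticePts d) {κ : Type*} [Fintype κ]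
    {φ : κ → Fin (d + 1) → ℝ} (hφ : Function.Injective φ) (hΛ : simplexLambda v = Set.range φ)
    {h : κ → ℕ} (hh : ∀ k, ∑ i, φ k i = h k) :
    HasDeltaPoly (convexHull ℝ (Set.range v)) (∑ k, X ^ h k) := by
  have hzero : ehrhartCount (convexHull ℝ (Set.range v)) 0 = 1 := by
    have hne : (convexHull ℝ (Set.range v)).Nonempty := (Set.range_nonempty v).convexHull
    have : latticePts d ∩ {0} = {0} :=
      Set.inter_eq_right.2 (Set.singleton_subset_iff.2 fun i => ⟨0, by simp⟩)
    rw [ehrhartCount, Nat.cast_zero, Set.zero_smul_set hne, ← Set.singleton_zero, this,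
      Set.ncard_singleton]
  have hseries : ehrhartSeries (convexHull ℝ (Set.range v)) =
      (∑ k, PowerSeries.X ^ h k) * PowerSeries.mk fun n => ((d + n).choose d : ℤ) := by
    ext n
    have : PowerSeries.coeff n (ehrhartSeries (convexHull ℝ (Set.range v))) =
        ehrhartCount (convexHull ℝ (Set.range v)) n := by
      rw [ehrhartSeries, PowerSeries.coeff_mk]
      split_ifs with hn
      · rw [hn, hzero, Nat.cast_one]
      · rfl
    rw [this, ehrhartCount_convexHull_range hv hvl hφ hΛ hh, Finset.sum_mul, map_sum]
    simp [PowerSeries.coeff_X_pow_mul']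
  rw [HasDeltaPoly, hseries, mul_left_comm, mul_comm (_ ^ _),
    PowerSeries.mk_add_choose_mul_one_sub_pow_eq_one, mul_one]
  rw [← Polynomial.coeToPowerSeries.ringHom_apply, map_sum]
  simp

theorem sum_blocks {d a b c : ℕ} (hd : d + 1 = a + b + c) (x y z : ℝ) :
    ∑ i : Fin (d + 1), (if (i : ℕ) < a then x else if (i : ℕ) < a + b then y else z) =
      a * x + b * y + c * z := by
  rw [Fin.sum_univ_eq_sum_range (fun i => if i < a then x else if i < a + b then y else z), hd,
    Finset.sum_range_add, Finset.sum_range_add]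
  congr 1
  · congr 1
    · rw [Finset.sum_congr rfl fun i hi => if_pos (Finset.mem_range.1 hi)]
      simp
    · rw [Finset.sum_congr rfl fun i hi => by
        rw [if_neg (by omega), if_pos (by have := Finset.mem_range.1 hi; omega)]]
      simp
  · rw [Finset.sum_congr rfl fun i hi => by rw [if_neg (by omega), if_neg (by omega)]]
    simp

/-- a lattice simplex whose group is `Λ₁(a,b,c)` has normalized volume 4 and
δ-polynomial `1 + t^{(a+2b+3c)/4} + t^{(a+c)/2} + t^{(3a+2b+c)/4}`. -/
theorem delta_of_lambdaOne_simplex (a b c : ℕ) (hac : 1 ≤ a + c)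
    (hmod : (a + 2 * b + 3 * c) % 4 = 0)
    (d : ℕ) (hd : d + 1 = a + b + c) (Δ : Set (Fin d → ℝ))
    (v : Fin (d + 1) → Fin d → ℝ) (hv : AffineIndependent ℝ v)
    (hvl : ∀ i, v i ∈ latticePts d) (hΔ : Δ = convexHull ℝ (Set.range v))
    (hΛ : simplexLambda v = lambdaOne d a b) :
    HasDeltaPoly Δ
      (1 + X ^ ((a + 2 * b + 3 * c) / 4) + X ^ ((a + c) / 2) +
        X ^ ((3 * a + 2 * b + c) / 4)) ∧
    ((1 + X ^ ((a + 2 * b + 3 * c) / 4) + X ^ ((a + c) / 2) +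
        X ^ ((3 * a + 2 * b + c) / 4) : Polynomial ℤ).eval 1 = 4) := by
  refine ⟨?_, by simp⟩
  subst hΔ
  let x : Fin 4 → ℝ := ![0, 1 / 4, 1 / 2, 3 / 4]
  let y : Fin 4 → ℝ := ![0, 1 / 2, 0, 1 / 2]
  let z : Fin 4 → ℝ := ![0, 3 / 4, 1 / 2, 1 / 4]
  let φ : Fin 4 → Fin (d + 1) → ℝ := fun k i =>
    if (i : ℕ) < a then x k else if (i : ℕ) < a + b then y k else z k
  let h : Fin 4 → ℕ := ![0, (a + 2 * b + 3 * c) / 4, (a + c) / 2, (3 * a + 2 * b + c) / 4]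
  have hrange : lambdaOne d a b = Set.range φ := by
    have key : ∀ k : Fin 4, (fun i : Fin (d + 1) => Int.fract ((k.val : ℝ) *
        (if (i : ℕ) < a then (1 : ℝ) / 4 else if (i : ℕ) < a + b then 1 / 2 else 3 / 4))) =
        φ k := by
      intro k
      funext i
      simp only [φ]
      fin_cases k <;> split_ifs <;> refine Int.fract_eq_iff.2 ⟨?_, ?_, ?_⟩
      all_goals try norm_num [x, y, z]; done
      all_goals
        first
        | refine ⟨0, ?_⟩; norm_num [x, y, z]; done
        | refine ⟨1, ?_⟩; norm_num [x, y, z]; done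
        | refine ⟨2, ?_⟩; norm_num [x, y, z]
    ext w
    simp only [lambdaOne, key, Set.mem_ofPred_eq, Set.mem_range, eq_comm]
  have hinj : Function.Injective φ := by
    intro k k' hkk
    rcases Nat.eq_zero_or_pos a with ha | ha
    · have h1 := congrFun hkk (Fin.last d)
      simp only [φ, Fin.val_last, if_neg (show ¬ d < a by omega),
        if_neg (show ¬ d < a + b by omega)] at h1
      fin_cases k <;> fin_cases k' <;> first | rfl | (norm_num [z] at h1)
    · have h1 : x k = x k' := by simpa [φ, ha] using congrFun hkk 0
      fin_cases k <;> fin_cases k' <;> first | rfl | (norm_num [x] at h1)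
  have hh : ∀ k, ∑ i, φ k i = h k := by
    intro k
    simp only [φ, sum_blocks hd]
    obtain ⟨p, hp⟩ : 4 ∣ a + 2 * b + 3 * c := by omega
    obtain ⟨q, hq⟩ : 2 ∣ a + c := by omega
    obtain ⟨r, hr⟩ : 4 ∣ 3 * a + 2 * b + c := by omega
    have hp' : (a + 2 * b + 3 * c : ℝ) = 4 * p := mod_cast hp
    have hq' : (a + c : ℝ) = 2 * q := mod_cast hq
    have hr' : (3 * a + 2 * b + c : ℝ) = 4 * r := mod_cast hr
    fin_cases k <;> simp [x, y, z, h, hp, hq, hr] <;> linarith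
  have hδ := hasDeltaPoly_convexHull_range hv hvl hinj (hΛ.trans hrange) hh
  simpa [Fin.sum_univ_four, h] using hδ
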